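/- The characteristic polynomial of the open-chain Hamiltonian H_L is (X² + 5)⁴·(X² + 1)⁴ for L = 4 sites, and (X⁴ + 8X² + 4)⁸ for L = 5 sites. -/

import Mathlib

noncomputable section

open Matrix Complex Polynomial

def Bmat : Matrix (Fin 2) (Fin 2) ℂ := !![0, 1; 1, 0]
def Cmat : Matrix (Fin 2) (Fin 2) ℂ := !![0, 1; -1, 0]

/-- The operator on `(ℂ²)^{⊗L}` acting as `f s` on the `s`-th tensor factor. -/
def siteOp (L : ℕ) (f : Fin L → Matrix (Fin 2) (Fin 2) ℂ) :
    Matrix (Fin L → Fin 2) (Fin L → Fin 2) ℂ :=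
  Matrix.of fun p q => ∏ s : Fin L, f s (p s) (q s)

/-- The open-chain Hamiltonian `H_L = Σ_{i=1}^{L−1} H_{i,i+1}`, where `H_{i,i+1}`
acts as `B` on site `i`, as `C` on site `i+1`, and as the identity elsewhere. -/
def Ham (L : ℕ) : Matrix (Fin L → Fin 2) (Fin L → Fin 2) ℂ :=
  ∑ i : Fin (L - 1), siteOp L fun s =>
    if (s : ℕ) = (i : ℕ) then Bmat else if (s : ℕ) = (i : ℕ) + 1 then Cmat else 1

lemma key_pow {n : Type} [Fintype n] [DecidableEq n] (H Y W : Matrix n n ℂ) (a c : ℂ)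
    (hT : Hᵀ = -H) (hH : H * H = 2 • Y - a • 1) (hY : Y * Y = c • 1)
    (hW : W * W = -1) (hWY : W * Y = -(Y * W)) :
    H.charpoly ^ 4 = ((X ^ 2 + C a) ^ 2 - C (4 * c)) ^ (Fintype.card n) := by
  have dW : W.det ≠ 0 := by
    intro h
    have h1 : (W * W).det * (-1 : Matrix n n ℂ).det = 1 := by
      rw [hW, ← det_mul]; simp
    rw [det_mul, h] at h1
    simp at h1
  apply Polynomial.funext
  intro z
  have e1 : (H.charpoly).eval z = (z • (1 : Matrix n n ℂ) - H).det := by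
    rw [Matrix.eval_charpoly, Matrix.scalar_apply, ← Matrix.smul_one_eq_diagonal]
  have e2 : (z • (1 : Matrix n n ℂ) - H).det = (z • (1 : Matrix n n ℂ) + H).det := by
    rw [← det_transpose]; simp [hT]
  set w : ℂ := z ^ 2 + a with hw
  have e3 : (z • (1 : Matrix n n ℂ) - H).det ^ 2 = (w • (1 : Matrix n n ℂ) - 2 • Y).det := by
    rw [sq]
    nth_rewrite 2 [e2]
    rw [← det_mul]
    congr 1
    have : (z • (1 : Matrix n n ℂ) - H) * (z • (1 : Matrix n n ℂ) + H)
        = (z ^ 2) • (1 : Matrix n n ℂ) - H * H := by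
      simp only [sub_mul, mul_add, smul_mul_assoc, mul_smul_comm, one_mul, mul_one]
      module
    rw [this, hH, hw]
    module
  have e4 : (w • (1 : Matrix n n ℂ) - 2 • Y).det = (w • (1 : Matrix n n ℂ) + 2 • Y).det := by
    have : W * (w • (1 : Matrix n n ℂ) - 2 • Y) = (w • (1 : Matrix n n ℂ) + 2 • Y) * W := by
      simp only [mul_sub, add_mul, smul_mul_assoc, mul_smul_comm, one_mul, mul_one, hWY]
      module
    have h2 := congrArg det this
    rw [det_mul, det_mul, mul_comm] at h2
    exact mul_right_cancel₀ dW h2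
  have e5 : (w • (1 : Matrix n n ℂ) - 2 • Y).det ^ 2 = (w ^ 2 - 4 * c) ^ (Fintype.card n) := by
    rw [sq]
    nth_rewrite 2 [e4]
    rw [← det_mul]
    have : (w • (1 : Matrix n n ℂ) - 2 • Y) * (w • (1 : Matrix n n ℂ) + 2 • Y)
        = (w ^ 2 - 4 * c) • (1 : Matrix n n ℂ) := by
      have : (w • (1 : Matrix n n ℂ) - 2 • Y) * (w • (1 : Matrix n n ℂ) + 2 • Y)
        = (w ^ 2) • (1 : Matrix n n ℂ) - 4 • (Y * Y) := by
        simp only [sub_mul, mul_add, smul_mul_assoc, mul_smul_comm, one_mul, mul_one]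
        module
      rw [this, hY]
      module
    rw [this, det_smul, det_one, mul_one]
  simp only [eval_pow, eval_sub, eval_add, eval_X, eval_C]
  rw [e1, ← hw, ← e5, ← e3]
  ring

lemma monic_pow_four {p q : ℂ[X]} (hp : p.Monic) (hq : q.Monic) (h : p ^ 4 = q ^ 4) : p = q := by
  apply eq_of_monic_of_associated hp hq
  apply associated_of_dvd_dvd
  · exact (IsIntegrallyClosed.pow_dvd_pow_iff (by norm_num)).1 h.dvd
  · exact (IsIntegrallyClosed.pow_dvd_pow_iff (by norm_num)).1 h.symm.dvd

lemma siteOp_mul (L : ℕ) (f g : Fin L → Matrix (Fin 2) (Fin 2) ℂ) :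
    siteOp L f * siteOp L g = siteOp L (fun s => f s * g s) := by
  ext p q
  simp only [siteOp, Matrix.mul_apply, Matrix.of_apply]
  rw [Finset.prod_univ_sum]
  simp [Finset.prod_mul_distrib]

lemma siteOp_transpose (L : ℕ) (f : Fin L → Matrix (Fin 2) (Fin 2) ℂ) :
    (siteOp L f)ᵀ = siteOp L (fun s => (f s)ᵀ) := by
  ext p q
  simp [siteOp]

lemma siteOp_one (L : ℕ) : siteOp L (fun _ => 1) = 1 := by
  ext p q
  simp only [siteOp, Matrix.of_apply, Matrix.one_apply]
  rw [Fintype.prod_ite_zero]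
  simp [funext_iff]

abbrev M2 := Matrix (Fin 2) (Fin 2) ℂ

def Dmat : M2 := !![1, 0; 0, -1]

def T4 (a b c d : M2) := siteOp 4 ![a, b, c, d]
def T5 (a b c d e : M2) := siteOp 5 ![a, b, c, d, e]

lemma T4_mul (a b c d a' b' c' d' : M2) :
    T4 a b c d * T4 a' b' c' d' = T4 (a * a') (b * b') (c * c') (d * d') := by
  unfold T4
  rw [siteOp_mul]
  congr 1; funext s; fin_cases s <;> rfl

lemma T5_mul (a b c d e a' b' c' d' e' : M2) :
    T5 a b c d e * T5 a' b' c' d' e' = T5 (a * a') (b * b') (c * c') (d * d') (e * e') := by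
  unfold T5
  rw [siteOp_mul]
  congr 1; funext s; fin_cases s <;> rfl

lemma T4_tr (a b c d : M2) : (T4 a b c d)ᵀ = T4 aᵀ bᵀ cᵀ dᵀ := by
  unfold T4
  rw [siteOp_transpose]
  congr 1; funext s; fin_cases s <;> rfl

lemma T5_tr (a b c d e : M2) : (T5 a b c d e)ᵀ = T5 aᵀ bᵀ cᵀ dᵀ eᵀ := by
  unfold T5
  rw [siteOp_transpose]
  congr 1; funext s; fin_cases s <;> rfl

lemma T4_one : T4 1 1 1 1 = 1 := by
  unfold T4
  rw [← siteOp_one]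
  congr 1; funext s; fin_cases s <;> rfl

lemma T5_one : T5 1 1 1 1 1 = 1 := by
  unfold T5
  rw [← siteOp_one]
  congr 1; funext s; fin_cases s <;> rfl

lemma T4_neg (a b c d : M2) : T4 (-a) b c d = -T4 a b c d ∧ T4 a (-b) c d = -T4 a b c d ∧
    T4 a b (-c) d = -T4 a b c d ∧ T4 a b c (-d) = -T4 a b c d := by
  refine ⟨?_, ?_, ?_, ?_⟩ <;> ext p q <;> simp [T4, siteOp, Fin.prod_univ_succ]

lemma T5_neg (a b c d e : M2) : T5 (-a) b c d e = -T5 a b c d e ∧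
    T5 a (-b) c d e = -T5 a b c d e ∧ T5 a b (-c) d e = -T5 a b c d e ∧
    T5 a b c (-d) e = -T5 a b c d e ∧ T5 a b c d (-e) = -T5 a b c d e := by
  refine ⟨?_, ?_, ?_, ?_, ?_⟩ <;> ext p q <;> simp [T5, siteOp, Fin.prod_univ_succ]

lemma tBB : Bmat * Bmat = 1 := by simp [Bmat, Matrix.one_fin_two]
lemma tCC : Cmat * Cmat = -1 := by simp [Cmat, Matrix.one_fin_two]
lemma tDD : Dmat * Dmat = 1 := by simp [Dmat, Matrix.one_fin_two]
lemma tCB : Cmat * Bmat = Dmat := by simp [Bmat, Cmat, Dmat]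
lemma tBC : Bmat * Cmat = -Dmat := by simp [Bmat, Cmat, Dmat]
lemma tDB : Dmat * Bmat = Cmat := by simp [Bmat, Cmat, Dmat]
lemma tBD : Bmat * Dmat = -Cmat := by simp [Bmat, Cmat, Dmat]
lemma tDC : Dmat * Cmat = Bmat := by simp [Bmat, Cmat, Dmat]
lemma tCD : Cmat * Dmat = -Bmat := by simp [Bmat, Cmat, Dmat]
lemma trB : Bmatᵀ = Bmat := by ext i j; fin_cases i <;> fin_cases j <;> simp [Bmat]
lemma trC : Cmatᵀ = -Cmat := by ext i j; fin_cases i <;> fin_cases j <;> simp [Cmat]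

lemma Ham4_eq : Ham 4 = T4 Bmat Cmat 1 1 + T4 1 Bmat Cmat 1 + T4 1 1 Bmat Cmat := by
  unfold Ham T4
  rw [show (4 - 1 : ℕ) = 3 from rfl, Fin.sum_univ_three]
  congr 1

lemma Ham5_eq : Ham 5 = T5 Bmat Cmat 1 1 1 + T5 1 Bmat Cmat 1 1 + T5 1 1 Bmat Cmat 1
    + T5 1 1 1 Bmat Cmat := by
  unfold Ham T5
  rw [show (5 - 1 : ℕ) = 4 from rfl, Fin.sum_univ_four]
  congr 1

lemma Ham4_pow : (Ham 4).charpoly ^ 4 = ((X ^ 2 + C 3) ^ 2 - C (4 * 1)) ^ 16 := by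
  have := key_pow (Ham 4) (T4 Bmat Cmat Bmat Cmat) (T4 Cmat 1 1 1) 3 1
    (by simp only [Ham4_eq, transpose_add, T4_tr, trB, trC, transpose_one, T4_neg]; abel)
    (by
      simp only [Ham4_eq, mul_add, add_mul, T4_mul, tBB, tCC, tDD, tCB, tBC, tDB, tBD, tDC, tCD,
        mul_one, one_mul, T4_neg, neg_neg, T4_one]
      module)
    (by
      simp only [T4_mul, tBB, tCC, T4_neg, neg_neg, T4_one]
      module)
    (by simp only [T4_mul, tCC, mul_one, T4_neg, T4_one])
    (by simp only [T4_mul, tCB, tBC, mul_one, one_mul, T4_neg, neg_neg])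
  simpa using this

lemma Ham5_pow : (Ham 5).charpoly ^ 4 = ((X ^ 2 + C 4) ^ 2 - C (4 * 3)) ^ 32 := by
  have := key_pow (Ham 5) (T5 Bmat Cmat Bmat Cmat 1 + T5 Bmat Cmat 1 Bmat Cmat
      + T5 1 Bmat Cmat Bmat Cmat) (T5 Cmat 1 Bmat 1 1) 4 3
    (by simp only [Ham5_eq, transpose_add, T5_tr, trB, trC, transpose_one, T5_neg]; abel)
    (by
      simp only [Ham5_eq, mul_add, add_mul, T5_mul, tBB, tCC, tDD, tCB, tBC, tDB, tBD, tDC, tCD,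
        mul_one, one_mul, T5_neg, neg_neg, T5_one]
      module)
    (by
      simp only [mul_add, add_mul, T5_mul, tBB, tCC, tDD, tCB, tBC, tDB, tBD, tDC, tCD,
        mul_one, one_mul, T5_neg, neg_neg, T5_one]
      module)
    (by simp only [T5_mul, tCC, tBB, mul_one, T5_neg, T5_one])
    (by
      simp only [mul_add, add_mul, T5_mul, tBB, tCC, tCB, tBC, mul_one, one_mul, T5_neg, neg_neg]
      abel)
  simpa using this

/-- The characteristic polynomial of the open-chain Hamiltonian is
`(X² + 5)⁴·(X² + 1)⁴` for `L = 4` and `(X⁴ + 8X² + 4)⁸` for `L = 5`. -/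
theorem Ham_charpoly_4_5 :
    (Ham 4).charpoly = (X ^ 2 + 5) ^ 4 * (X ^ 2 + 1) ^ 4 ∧
    (Ham 5).charpoly = (X ^ 4 + 8 * X ^ 2 + 4) ^ 8 := by
  have c3 : (C 3 : ℂ[X]) = 3 := rfl
  have c4 : (C 4 : ℂ[X]) = 4 := rfl
  constructor
  · apply monic_pow_four (charpoly_monic _)
    · apply Monic.mul <;> apply Monic.pow
      · exact monic_X_pow_add_C 5 (by norm_num)
      · exact monic_X_pow_add_C 1 (by norm_num)
    · rw [Ham4_pow, mul_one, c3, c4,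
        show ((X : ℂ[X]) ^ 2 + 3) ^ 2 - 4 = (X ^ 2 + 5) * (X ^ 2 + 1) by ring]
      rw [← mul_pow, ← pow_mul]
  · apply monic_pow_four (charpoly_monic _)
    · apply Monic.pow
      have : (X ^ 4 + 8 * X ^ 2 + 4 : ℂ[X]) = X ^ 4 + (C 8 * X ^ 2 + C 4) := by
        rw [add_assoc]; rfl
      rw [this]
      apply monic_X_pow_add
      compute_degree!
    · rw [Ham5_pow, C_mul, c3, c4,
        show ((X : ℂ[X]) ^ 2 + 4) ^ 2 - 4 * 3 = X ^ 4 + 8 * X ^ 2 + 4 by ring]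
      rw [← pow_mul]
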